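/- Let p be an arbitrary probability distribution on [n]×[m], and suppose the loss ℓ is l-Lipschitz in its first argument and bounded by b. Then there is an absolute constant C such that the expected empirical Rademacher complexity of the loss class satisfies E_S[R̂_S(ℓ∘W_p)] ≤ C·(l+b)·(r·n·log(n)/s)^{1/3}, where the expectation is over a sample S of size s drawn i.i.d. from p, and ℓ∘W_p is the class of functions (i,j) ↦ ℓ(X_{ij}, Y_{ij}) for X ∈ W_p. -/

import Mathlib

open scoped Classical
open Matrix Finset

noncomputable section

/-- Trace norm (sum of singular values) of a real matrix. -/
def traceNorm {n m : ℕ} (X : Matrix (Fin n) (Fin m) ℝ) : ℝ :=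
  ∑ j, Real.sqrt ((Matrix.isHermitian_conjTranspose_mul_self X).eigenvalues j)

/-- Weighted trace norm with row weights `pr` and column weights `pc`. -/
def wTrNorm {n m : ℕ} (pr : Fin n → ℝ) (pc : Fin m → ℝ)
    (X : Matrix (Fin n) (Fin m) ℝ) : ℝ :=
  traceNorm (Matrix.diagonal (fun i => Real.sqrt (pr i)) * X *
    Matrix.diagonal (fun j => Real.sqrt (pc j)))

/-- Weighted trace-norm ball of radius `√r`. -/
def Wball {n m : ℕ} (pr : Fin n → ℝ) (pc : Fin m → ℝ) (r : ℝ) :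
    Set (Matrix (Fin n) (Fin m) ℝ) :=
  {X | wTrNorm pr pc X ≤ Real.sqrt r}

/-- Row marginals of a distribution on `[n] × [m]`. -/
def rowMarg {n m : ℕ} (p : Matrix (Fin n) (Fin m) ℝ) (i : Fin n) : ℝ := ∑ j, p i j

/-- Column marginals of a distribution on `[n] × [m]`. -/
def colMarg {n m : ℕ} (p : Matrix (Fin n) (Fin m) ℝ) (j : Fin m) : ℝ := ∑ i, p i j

/-- `p` is a probability distribution on `[n] × [m]`. -/
def IsDistrib {n m : ℕ} (p : Matrix (Fin n) (Fin m) ℝ) : Prop :=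
  (∀ i j, 0 ≤ p i j) ∧ ∑ i, ∑ j, p i j = 1

/-- `ℓ` is `l`-Lipschitz in its first argument. -/
def LipLoss (l : ℝ) (ℓ : ℝ → ℝ → ℝ) : Prop :=
  ∀ x x' y, |ℓ x y - ℓ x' y| ≤ l * |x - x'|

/-- Probability of drawing the i.i.d. sample `S` from `p`. -/
def sampleProb {n m s : ℕ} (p : Matrix (Fin n) (Fin m) ℝ)
    (S : Fin s → Fin n × Fin m) : ℝ :=
  ∏ t, p (S t).1 (S t).2

/-- Expectation over an i.i.d. sample of size `s` drawn from `p`. -/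
def Esample {n m : ℕ} (s : ℕ) (p : Matrix (Fin n) (Fin m) ℝ)
    (f : (Fin s → Fin n × Fin m) → ℝ) : ℝ :=
  ∑ S : Fin s → Fin n × Fin m, sampleProb p S * f S

/-- Empirical risk of `X` on the sample `S` (target matrix `Y`, loss `ℓ`). -/
def empRisk {n m s : ℕ} (ℓ : ℝ → ℝ → ℝ) (Y : Matrix (Fin n) (Fin m) ℝ)
    (S : Fin s → Fin n × Fin m) (X : Matrix (Fin n) (Fin m) ℝ) : ℝ :=
  (1 / (s : ℝ)) * ∑ t, ℓ (X (S t).1 (S t).2) (Y (S t).1 (S t).2)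

/-- Population risk of `X` under sampling distribution `p`. -/
def popRisk {n m : ℕ} (p : Matrix (Fin n) (Fin m) ℝ) (ℓ : ℝ → ℝ → ℝ)
    (Y X : Matrix (Fin n) (Fin m) ℝ) : ℝ :=
  ∑ i, ∑ j, p i j * ℓ (X i j) (Y i j)

/-- Empirical Rademacher complexity of the loss class
`ℓ ∘ 𝒳 = {(i,j) ↦ ℓ(X_{ij}, Y_{ij}) : X ∈ 𝒳}` on the sample `S`. -/
def rademacherLoss {n m s : ℕ} (ℓ : ℝ → ℝ → ℝ) (Y : Matrix (Fin n) (Fin m) ℝ)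
    (S : Fin s → Fin n × Fin m) (𝒳 : Set (Matrix (Fin n) (Fin m) ℝ)) : ℝ :=
  (1 / 2 ^ s) * ∑ σ : Fin s → Bool,
    sSup ((fun X => (1 / (s : ℝ)) *
      ∑ t, (if σ t then (1 : ℝ) else -1) *
        ℓ (X (S t).1 (S t).2) (Y (S t).1 (S t).2)) '' 𝒳)


theorem aux_spec {ι : Type*} [Fintype ι] [DecidableEq ι] (W : Matrix ι ι ℝ)
    (hW : W.IsHermitian) :
    ∃ U : Matrix ι ι ℝ, Uᵀ * U = 1 ∧ U * Uᵀ = 1 ∧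
      W = U * Matrix.diagonal hW.eigenvalues * Uᵀ := by
  have hu := hW.eigenvectorUnitary.2
  refine ⟨hW.eigenvectorUnitary, ?_, ?_, ?_⟩
  · have := (Matrix.mem_unitaryGroup_iff').1 hu
    simpa [Matrix.star_eq_conjTranspose] using this
  · have := (Matrix.mem_unitaryGroup_iff).1 hu
    simpa [Matrix.star_eq_conjTranspose] using this
  · have := hW.spectral_theorem
    rw [Unitary.conjStarAlgAut_apply] at this
    simpa [Matrix.star_eq_conjTranspose, Function.comp_def] using this

theorem aux_specpow {ι : Type*} [Fintype ι] [DecidableEq ι] (U : Matrix ι ι ℝ) (e : ι → ℝ)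
    (h1 : Uᵀ * U = 1) (h2 : U * Uᵀ = 1) (k : ℕ) :
    (U * Matrix.diagonal e * Uᵀ) ^ k = U * Matrix.diagonal (fun a => e a ^ k) * Uᵀ := by
  induction k with
  | zero => simp [h2]
  | succ k ih =>
    rw [pow_succ, ih]
    calc _ = U * Matrix.diagonal (fun a => e a ^ k) * (Uᵀ * U) * Matrix.diagonal e * Uᵀ := by
          simp only [Matrix.mul_assoc]
      _ = _ := by
          rw [h1, Matrix.mul_one, Matrix.mul_assoc U, Matrix.diagonal_mul_diagonal]
          simp only [pow_succ]

theorem aux_scalar1 (a b : ℝ) (k q : ℕ) (hk : Even k) (hq : q ≤ k) :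
    a ^ q * b ^ (k - q) + a ^ (k - q) * b ^ q ≤ a ^ k + b ^ k := by
  obtain ⟨j, rfl⟩ := Nat.exists_eq_add_of_le hq
  rw [Nat.add_sub_cancel_left, ← hk.pow_abs a, ← hk.pow_abs b]
  have h1 : a ^ q * b ^ j ≤ |a| ^ q * |b| ^ j := by
    rw [← abs_pow, ← abs_pow, ← abs_mul]; exact le_abs_self _
  have h2 : a ^ j * b ^ q ≤ |a| ^ j * |b| ^ q := by
    rw [← abs_pow, ← abs_pow, ← abs_mul]; exact le_abs_self _
  have h3 : 0 ≤ (|a| ^ q - |b| ^ q) * (|a| ^ j - |b| ^ j) := by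
    rcases le_total |a| |b| with h | h
    · exact mul_nonneg_of_nonpos_of_nonpos
        (sub_nonpos.2 (pow_le_pow_left₀ (abs_nonneg _) h _))
        (sub_nonpos.2 (pow_le_pow_left₀ (abs_nonneg _) h _))
    · exact mul_nonneg
        (sub_nonneg.2 (pow_le_pow_left₀ (abs_nonneg _) h _))
        (sub_nonneg.2 (pow_le_pow_left₀ (abs_nonneg _) h _))
  rw [pow_add, pow_add]
  nlinarith

theorem aux_scalar (a b : ℝ) (k : ℕ) (hk : Even k) :
    2 * ∑ q ∈ range (k + 1), a ^ q * b ^ (k - q) ≤ (k + 1) * (a ^ k + b ^ k) := by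
  have h : ∑ q ∈ range (k + 1), a ^ q * b ^ (k - q)
      = ∑ q ∈ range (k + 1), a ^ (k - q) * b ^ q := by
    rw [← Finset.sum_range_reflect]
    refine Finset.sum_congr rfl fun q hq => ?_
    have : q ≤ k := by simpa [Nat.lt_succ_iff] using hq
    have e1 : k + 1 - 1 - q = k - q := by omega
    have e2 : k - (k - q) = q := by omega
    rw [e1, e2]
  rw [two_mul]
  nth_rw 2 [h]
  rw [← Finset.sum_add_distrib]
  calc _ ≤ ∑ q ∈ range (k + 1), (a ^ k + b ^ k) := by
        refine Finset.sum_le_sum fun q hq => aux_scalar1 a b k q hk ?_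
        simpa [Nat.lt_succ_iff] using hq
    _ = _ := by simp; ring

theorem aux_trform {ι : Type*} [Fintype ι] [DecidableEq ι] (H U V : Matrix ι ι ℝ) (e f : ι → ℝ)
    (hH : Hᵀ = H) :
    (H * (U * Matrix.diagonal e * Uᵀ) * H * (V * Matrix.diagonal f * Vᵀ)).trace
      = ∑ b, ∑ a, (Uᵀ * H * V) a b ^ 2 * (e a * f b) := by
  have : (H * (U * Matrix.diagonal e * Uᵀ) * H * (V * Matrix.diagonal f * Vᵀ)).trace
      = ((Uᵀ * H * V)ᵀ * Matrix.diagonal e * (Uᵀ * H * V) * Matrix.diagonal f).trace := by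
    rw [← Matrix.mul_assoc, Matrix.trace_mul_comm]
    simp only [Matrix.transpose_mul, Matrix.transpose_transpose, hH, Matrix.mul_assoc]
  rw [this, Matrix.trace]
  refine Finset.sum_congr rfl fun b _ => ?_
  rw [Matrix.diag_apply, Matrix.mul_diagonal, Matrix.mul_apply, Finset.sum_mul]
  refine Finset.sum_congr rfl fun a _ => ?_
  rw [Matrix.mul_diagonal, Matrix.transpose_apply]
  ring

theorem aux_gmam {ι : Type*} [Fintype ι] [DecidableEq ι] (H W Y : Matrix ι ι ℝ)
    (hH : Hᵀ = H) (hW : Wᵀ = W) (hY : Yᵀ = Y) (k : ℕ) (hk : Even k) :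
    2 * ∑ q ∈ range (k + 1), (H * W ^ q * H * Y ^ (k - q)).trace
      ≤ (k + 1) * ((H * H * W ^ k).trace + (H * H * Y ^ k).trace) := by
  have hW' : W.IsHermitian := by simpa [Matrix.IsHermitian] using hW
  have hY' : Y.IsHermitian := by simpa [Matrix.IsHermitian] using hY
  obtain ⟨U, hU1, hU2, hU⟩ := aux_spec W hW'
  obtain ⟨V, hV1, hV2, hV⟩ := aux_spec Y hY'
  set e := hW'.eigenvalues
  set f := hY'.eigenvalues
  have key : ∀ q q' : ℕ, (H * W ^ q * H * Y ^ q').trace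
      = ∑ b, ∑ a, (Uᵀ * H * V) a b ^ 2 * (e a ^ q * f b ^ q') := by
    intro q q'
    rw [hU, hV, aux_specpow U e hU1 hU2, aux_specpow V f hV1 hV2, aux_trform _ _ _ _ _ hH]
  have k1 : (H * H * W ^ k).trace = (H * W ^ k * H * Y ^ 0).trace := by
    rw [pow_zero, Matrix.mul_one, Matrix.mul_assoc, Matrix.trace_mul_comm]
  have k2 : (H * H * Y ^ k).trace = (H * W ^ 0 * H * Y ^ k).trace := by
    rw [pow_zero, Matrix.mul_one]
  rw [k1, k2]
  simp only [key]
  rw [Finset.sum_comm, ← Finset.sum_add_distrib, Finset.mul_sum, Finset.mul_sum]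
  refine Finset.sum_le_sum fun b _ => ?_
  rw [Finset.sum_comm, ← Finset.sum_add_distrib, Finset.mul_sum, Finset.mul_sum]
  refine Finset.sum_le_sum fun a _ => ?_
  rw [← Finset.mul_sum, ← mul_add]
  have := mul_le_mul_of_nonneg_left (aux_scalar (e a) (f b) k hk)
    (sq_nonneg ((Uᵀ * H * V) a b))
  simp only [pow_zero, mul_one, one_mul]
  linarith

theorem aux_tele {ι : Type*} [Fintype ι] [DecidableEq ι] (W Y : Matrix ι ι ℝ) (k : ℕ) :
    W ^ (k + 1) - Y ^ (k + 1) = ∑ q ∈ range (k + 1), W ^ q * (W - Y) * Y ^ (k - q) := by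
  induction k with
  | zero => simp
  | succ k ih =>
    rw [Finset.sum_range_succ]
    have : ∑ q ∈ range (k + 1), W ^ q * (W - Y) * Y ^ (k + 1 - q)
        = (∑ q ∈ range (k + 1), W ^ q * (W - Y) * Y ^ (k - q)) * Y := by
      rw [Finset.sum_mul]
      refine Finset.sum_congr rfl fun q hq => ?_
      have hq' : q ≤ k := by simpa [Nat.lt_succ_iff] using hq
      rw [Nat.succ_sub hq', pow_succ, Matrix.mul_assoc (W ^ q * (W - Y))]
    rw [this, ← ih]
    simp only [Nat.sub_self, pow_zero, Matrix.mul_one]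
    rw [Matrix.sub_mul, Matrix.mul_sub, ← pow_succ, ← pow_succ, ]
    abel

def sg (b : Bool) : ℝ := if b then 1 else -1

theorem sg_sq (b : Bool) : sg b * sg b = 1 := by cases b <;> simp [sg]
theorem sg_not (b : Bool) : sg (!b) = - sg b := by cases b <;> simp [sg]

def radM {ι : Type*} {s : ℕ} (A : Fin s → Matrix ι ι ℝ)
    (σ : Fin s → Bool) : Matrix ι ι ℝ := ∑ t, sg (σ t) • A t

def flip1 {s : ℕ} (t : Fin s) (σ : Fin s → Bool) : Fin s → Bool :=
  fun u => if u = t then !σ u else σ u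

theorem flip1_flip1 {s : ℕ} (t : Fin s) (σ : Fin s → Bool) : flip1 t (flip1 t σ) = σ := by
  funext u; by_cases h : u = t <;> simp [flip1, h]

theorem sum_flip1 {s : ℕ} (t : Fin s) (f : (Fin s → Bool) → ℝ) :
    ∑ σ, f (flip1 t σ) = ∑ σ, f σ :=
  Equiv.sum_comp (⟨flip1 t, flip1 t, flip1_flip1 t, flip1_flip1 t⟩ : (Fin s → Bool) ≃ (Fin s → Bool)) f

theorem radM_flip {ι : Type*} {s : ℕ} (A : Fin s → Matrix ι ι ℝ) (t : Fin s)
    (σ : Fin s → Bool) : radM A σ - radM A (flip1 t σ) = (2 * sg (σ t)) • A t := by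
  rw [radM, radM, ← Finset.sum_sub_distrib, Finset.sum_eq_single t]
  · simp [flip1, sg_not, two_mul, add_smul]
  · intro u _ hu; simp [flip1, hu]
  · simp

theorem radM_symm {ι : Type*} {s : ℕ} (A : Fin s → Matrix ι ι ℝ)
    (hA : ∀ t, (A t)ᵀ = A t) (σ : Fin s → Bool) : (radM A σ)ᵀ = radM A σ := by
  simp [radM, Matrix.transpose_sum, hA]

theorem aux_step1 {ι : Type*} [Fintype ι] [DecidableEq ι] {s : ℕ} (A : Fin s → Matrix ι ι ℝ)
    (hA : ∀ t, (A t)ᵀ = A t) (k : ℕ) (hk : Even k) (t : Fin s) :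
    ∑ σ, sg (σ t) * (A t * radM A σ ^ (k + 1)).trace
      ≤ (k + 1) * ∑ σ, (A t * A t * radM A σ ^ k).trace := by
  have h1 : ∑ σ, sg (σ t) * (A t * radM A σ ^ (k + 1)).trace
      = - ∑ σ, sg (σ t) * (A t * radM A (flip1 t σ) ^ (k + 1)).trace := by
    rw [← sum_flip1 t, ← Finset.sum_neg_distrib]
    refine Finset.sum_congr rfl fun σ _ => ?_
    simp [flip1, sg_not]
  have h2 : ∑ σ, (A t * A t * radM A σ ^ k).trace
      = ∑ σ, (A t * A t * radM A (flip1 t σ) ^ k).trace := (sum_flip1 t _).symm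
  have h3 : 2 * ∑ σ, sg (σ t) * (A t * radM A σ ^ (k + 1)).trace
      = ∑ σ, sg (σ t) * (A t * (radM A σ ^ (k + 1) - radM A (flip1 t σ) ^ (k + 1))).trace := by
    rw [two_mul]
    nth_rw 2 [h1]
    rw [← sub_eq_add_neg, ← Finset.sum_sub_distrib]
    refine Finset.sum_congr rfl fun σ _ => ?_
    rw [Matrix.mul_sub, Matrix.trace_sub]; ring
  have h4 : ∀ σ : Fin s → Bool,
      sg (σ t) * (A t * (radM A σ ^ (k + 1) - radM A (flip1 t σ) ^ (k + 1))).trace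
      = 2 * ∑ q ∈ range (k + 1),
        (A t * radM A σ ^ q * A t * radM A (flip1 t σ) ^ (k - q)).trace := by
    intro σ
    rw [aux_tele, radM_flip, Matrix.mul_sum, Matrix.trace_sum, Finset.mul_sum, Finset.mul_sum]
    refine Finset.sum_congr rfl fun q _ => ?_
    rw [Matrix.mul_smul, Matrix.smul_mul, Matrix.mul_smul, Matrix.trace_smul, smul_eq_mul,
      ← Matrix.mul_assoc, ← Matrix.mul_assoc]
    linear_combination (2 * (A t * radM A σ ^ q * A t * radM A (flip1 t σ) ^ (k - q)).trace) * sg_sq (σ t)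
  have h5 : 2 * ∑ σ, sg (σ t) * (A t * radM A σ ^ (k + 1)).trace
      ≤ ∑ σ, ((k : ℝ) + 1) * ((A t * A t * radM A σ ^ k).trace
        + (A t * A t * radM A (flip1 t σ) ^ k).trace) := by
    rw [h3]
    refine Finset.sum_le_sum fun σ _ => ?_
    rw [h4]
    exact aux_gmam _ _ _ (hA t) (radM_symm A hA _) (radM_symm A hA _) k hk
  rw [← Finset.mul_sum, Finset.sum_add_distrib, ← h2] at h5
  linarith

theorem aux_pow_diag_nonneg {ι : Type*} [Fintype ι] [DecidableEq ι] (X : Matrix ι ι ℝ)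
    (hX : Xᵀ = X) (k : ℕ) (a : ι) : 0 ≤ (X ^ (2 * k)) a a := by
  have h : (X ^ k)ᵀ = X ^ k := by rw [Matrix.transpose_pow, hX]
  rw [two_mul, pow_add]
  nth_rw 1 [← h]
  rw [Matrix.mul_apply]
  exact Finset.sum_nonneg fun b _ => by rw [Matrix.transpose_apply]; exact mul_self_nonneg _

theorem aux_khin1 {ι : Type*} [Fintype ι] [DecidableEq ι] {s : ℕ} (A : Fin s → Matrix ι ι ℝ)
    (hA : ∀ t, (A t)ᵀ = A t) (z : ι → ℝ) (V : ℝ) (hz : ∑ t, A t * A t = Matrix.diagonal z)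
    (hV : ∀ a, z a ≤ V) (k : ℕ) :
    ∑ σ, (radM A σ ^ (2 * (k + 1))).trace
      ≤ (2 * k + 1) * V * ∑ σ, (radM A σ ^ (2 * k)).trace := by
  have h1 : ∀ σ, (radM A σ ^ (2 * (k + 1))).trace
      = ∑ t, sg (σ t) * (A t * radM A σ ^ (2 * k + 1)).trace := by
    intro σ
    have : 2 * (k + 1) = (2 * k + 1) + 1 := by ring
    rw [this, pow_succ']
    nth_rw 1 [radM]
    rw [Finset.sum_mul, Matrix.trace_sum]
    simp
  have h2 : ∑ σ, (radM A σ ^ (2 * (k + 1))).trace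
      ≤ ∑ t, (2 * k + 1) * ∑ σ, (A t * A t * radM A σ ^ (2 * k)).trace := by
    simp only [h1]
    rw [Finset.sum_comm]
    refine Finset.sum_le_sum fun t _ => ?_
    have := aux_step1 A hA (2 * k) (even_two_mul k) t
    push_cast at this
    exact this
  refine h2.trans ?_
  rw [← Finset.mul_sum, mul_assoc, Finset.sum_comm]
  refine mul_le_mul_of_nonneg_left ?_ (by positivity)
  rw [Finset.mul_sum]
  refine Finset.sum_le_sum fun σ _ => ?_
  rw [← Matrix.trace_sum, ← Finset.sum_mul, hz, Matrix.trace, Matrix.trace, Finset.mul_sum]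
  refine Finset.sum_le_sum fun a _ => ?_
  rw [Matrix.diag_apply, Matrix.diag_apply, Matrix.diagonal_mul]
  exact mul_le_mul_of_nonneg_right (hV a) (aux_pow_diag_nonneg _ (radM_symm A hA σ) k a)

theorem aux_trace_nonneg {ι : Type*} [Fintype ι] [DecidableEq ι] (X : Matrix ι ι ℝ)
    (hX : Xᵀ = X) (k : ℕ) : 0 ≤ (X ^ (2 * k)).trace :=
  Finset.sum_nonneg fun a _ => aux_pow_diag_nonneg X hX k a

theorem aux_khin {ι : Type*} [Fintype ι] [DecidableEq ι] {s : ℕ} (A : Fin s → Matrix ι ι ℝ)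
    (hA : ∀ t, (A t)ᵀ = A t) (z : ι → ℝ) (V : ℝ) (hV0 : 0 ≤ V)
    (hz : ∑ t, A t * A t = Matrix.diagonal z)
    (hV : ∀ a, z a ≤ V) (P k : ℕ) (hk : k ≤ P) :
    ∑ σ, (radM A σ ^ (2 * k)).trace ≤ (2 * P * V) ^ k * (2 ^ s * Fintype.card ι) := by
  induction k with
  | zero => simp
  | succ k ih =>
    have ih := ih (by omega)
    have h0 : 0 ≤ ∑ σ, (radM A σ ^ (2 * k)).trace :=
      Finset.sum_nonneg fun σ _ => aux_trace_nonneg _ (radM_symm A hA σ) k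
    have hP : (k : ℝ) + 1 ≤ P := by exact_mod_cast hk
    calc _ ≤ (2 * k + 1) * V * ∑ σ, (radM A σ ^ (2 * k)).trace := aux_khin1 A hA z V hz hV k
      _ ≤ (2 * P) * V * ((2 * P * V) ^ k * (2 ^ s * Fintype.card ι)) := by
          gcongr
          linarith
      _ = _ := by ring

theorem aux_norm {ι : Type*} [Fintype ι] [DecidableEq ι] (X : Matrix ι ι ℝ)
    (hX : Xᵀ = X) (u : ι → ℝ) (hu : u ⬝ᵥ u = 1) (k : ℕ) :
    ((X *ᵥ u) ⬝ᵥ (X *ᵥ u)) ^ k ≤ (X ^ (2 * k)).trace := by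
  have hX' : X.IsHermitian := by simpa [Matrix.IsHermitian] using hX
  obtain ⟨U, hU1, hU2, hU⟩ := aux_spec X hX'
  set e := hX'.eigenvalues
  set c := Uᵀ *ᵥ u with hc
  have hcc : ∑ a, c a ^ 2 = 1 := by
    have : c ⬝ᵥ c = u ⬝ᵥ u := by
      rw [hc, Matrix.dotProduct_mulVec, Matrix.vecMul_transpose, Matrix.mulVec_mulVec, hU2,
        Matrix.one_mulVec]
    rw [hu] at this
    rw [← this]
    simp [dotProduct, sq]
  have h1 : (X *ᵥ u) ⬝ᵥ (X *ᵥ u) = ∑ a, c a ^ 2 * e a ^ 2 := by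
    have h2 : (X *ᵥ u) ⬝ᵥ (X *ᵥ u) = u ⬝ᵥ ((X ^ 2) *ᵥ u) := by
      rw [Matrix.dotProduct_mulVec, ← Matrix.mulVec_transpose, hX, Matrix.mulVec_mulVec, sq,
        dotProduct_comm]
    rw [h2, hU, aux_specpow U e hU1 hU2, ← Matrix.mulVec_mulVec, ← hc, ← Matrix.mulVec_mulVec,
      Matrix.dotProduct_mulVec, ← Matrix.mulVec_transpose, ← hc]
    simp only [dotProduct, Matrix.mulVec_diagonal]
    exact Finset.sum_congr rfl fun a _ => by ring
  have h3 : (X ^ (2 * k)).trace = ∑ a, (e a ^ 2) ^ k := by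
    rw [hU, aux_specpow U e hU1 hU2, Matrix.trace_mul_comm, ← Matrix.mul_assoc, hU1,
      Matrix.one_mul, Matrix.trace_diagonal]
    exact Finset.sum_congr rfl fun a _ => by rw [pow_mul]
  rw [h1, h3]
  refine (Real.pow_arith_mean_le_arith_mean_pow _ _ _ (fun a _ => sq_nonneg _) hcc
    (fun a _ => sq_nonneg _) k).trans ?_
  refine Finset.sum_le_sum fun a _ => ?_
  have : c a ^ 2 ≤ 1 := by
    rw [← hcc]
    exact Finset.single_le_sum (f := fun a => c a ^ 2) (fun a _ => sq_nonneg _) (Finset.mem_univ a)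
  have h0 : 0 ≤ (e a ^ 2) ^ k := by positivity
  nlinarith

theorem aux_dual {n m : ℕ} (G X : Matrix (Fin n) (Fin m) ℝ) (K : ℝ) (hK : 0 ≤ K)
    (hG : ∀ v : Fin m → ℝ, v ⬝ᵥ v = 1 → (G *ᵥ v) ⬝ᵥ (G *ᵥ v) ≤ K ^ 2) :
    ∑ i, ∑ j, G i j * X i j ≤ K * traceNorm X := by
  obtain ⟨U, hU1, hU2, hU⟩ := aux_spec (Xᴴ * X) (Matrix.isHermitian_conjTranspose_mul_self X)
  rw [traceNorm]
  set e := (Matrix.isHermitian_conjTranspose_mul_self X).eigenvalues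
  have h1 : ∑ i, ∑ j, G i j * X i j = ∑ j, ∑ i, (G * U) i j * (X * U) i j := by
    have e1 : ∑ i, ∑ j, G i j * X i j = (Gᵀ * X).trace := by
      rw [Finset.sum_comm]; simp [Matrix.trace, Matrix.mul_apply]
    have e2 : ∑ j, ∑ i, (G * U) i j * (X * U) i j = ((G * U)ᵀ * (X * U)).trace := by
      refine Finset.sum_congr rfl fun j _ => ?_
      rw [Matrix.diag_apply, Matrix.mul_apply]; rfl
    rw [e1, e2, Matrix.transpose_mul, Matrix.mul_assoc, ← Matrix.mul_assoc Gᵀ X U,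
      Matrix.trace_mul_comm Uᵀ, Matrix.mul_assoc, Matrix.mul_assoc, hU2, Matrix.mul_one]
  rw [h1, Finset.mul_sum]
  refine Finset.sum_le_sum fun j _ => ?_
  refine (Real.sum_mul_le_sqrt_mul_sqrt _ _ _).trans ?_
  have h2 : ∑ i, (X * U) i j ^ 2 = e j := by
    have : ((X * U)ᵀ * (X * U)) = Matrix.diagonal e := by
      rw [Matrix.transpose_mul, Matrix.mul_assoc, ← Matrix.mul_assoc Xᵀ X U]
      rw [Matrix.conjTranspose_eq_transpose_of_trivial] at hU
      rw [hU, Matrix.mul_assoc, hU1, Matrix.mul_one, ← Matrix.mul_assoc, hU1, Matrix.one_mul]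
    have h := congrFun (congrFun this j) j
    rw [Matrix.mul_apply, Matrix.diagonal_apply_eq] at h
    rw [← h]
    simp [sq]
  have h3 : ∑ i, (G * U) i j ^ 2 ≤ K ^ 2 := by
    have hv : (fun a => U a j) ⬝ᵥ (fun a => U a j) = 1 := by
      have h := congrFun (congrFun hU1 j) j
      rw [Matrix.mul_apply, Matrix.one_apply_eq] at h
      rw [← h]; simp [dotProduct]
    refine le_trans (le_of_eq ?_) (hG _ hv)
    simp [dotProduct, Matrix.mulVec, Matrix.mul_apply, sq]
  rw [h2]
  refine mul_le_mul_of_nonneg_right ?_ (Real.sqrt_nonneg _)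
  exact (Real.sqrt_le_sqrt h3).trans (by rw [Real.sqrt_sq hK])

theorem aux_contr {T : Type*} : ∀ (s : ℕ) (F G : Fin s → T → ℝ) (h : T → ℝ)
    (_ : ∀ t x y, |F t x - F t y| ≤ |G t x - G t y|) (B : (Fin s → Bool) → ℝ)
    (_ : ∀ σ x, h x + ∑ t, sg (σ t) * G t x ≤ B σ) (x : (Fin s → Bool) → T),
    ∑ σ, (h (x σ) + ∑ t, sg (σ t) * F t (x σ)) ≤ ∑ σ, B σ := by
  intro s
  induction s with
  | zero =>
    intro F G h _ B hB x
    refine Finset.sum_le_sum fun σ _ => ?_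
    simpa using hB σ (x σ)
  | succ s ih =>
    intro F G h hFG B hB x
    have hsum : ∀ f : (Fin (s + 1) → Bool) → ℝ, ∑ σ, f σ
        = ∑ σ : Fin s → Bool, (f (Fin.cons true σ) + f (Fin.cons false σ)) := by
      intro f
      rw [← (Fin.consEquiv (fun _ => Bool)).sum_comp, Fintype.sum_prod_type, Fintype.sum_bool,
        ← Finset.sum_add_distrib]
      rfl
    rw [hsum, hsum]
    let u : (Fin s → Bool) → T := fun σ =>
      if G 0 (x (Fin.cons false σ)) ≤ G 0 (x (Fin.cons true σ)) then x (Fin.cons true σ)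
      else x (Fin.cons false σ)
    let v : (Fin s → Bool) → T := fun σ =>
      if G 0 (x (Fin.cons false σ)) ≤ G 0 (x (Fin.cons true σ)) then x (Fin.cons false σ)
      else x (Fin.cons true σ)
    have hu := ih (fun t => F t.succ) (fun t => G t.succ) (fun y => h y + G 0 y)
      (fun _ x y => hFG _ x y) (fun σ => B (Fin.cons true σ))
      (fun σ y => by
        have := hB (Fin.cons true σ) y
        rw [Fin.sum_univ_succ] at this
        simp only [Fin.cons_zero, Fin.cons_succ] at this
        simp only [sg, if_true, one_mul] at this ⊢
        linarith) u
    have hv := ih (fun t => F t.succ) (fun t => G t.succ) (fun y => h y - G 0 y)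
      (fun _ x y => hFG _ x y) (fun σ => B (Fin.cons false σ))
      (fun σ y => by
        have := hB (Fin.cons false σ) y
        rw [Fin.sum_univ_succ] at this
        simp only [Fin.cons_zero, Fin.cons_succ] at this
        simp [sg] at this ⊢
        linarith) v
    rw [Finset.sum_add_distrib (f := fun σ => B (Fin.cons true σ))]
    refine le_trans ?_ (add_le_add hu hv)
    rw [← Finset.sum_add_distrib]
    refine Finset.sum_le_sum fun σ _ => ?_
    rw [Fin.sum_univ_succ, Fin.sum_univ_succ]
    simp only [Fin.cons_zero, Fin.cons_succ]
    have h0 := hFG 0 (x (Fin.cons true σ)) (x (Fin.cons false σ))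
    have h1 := (le_abs_self _).trans h0
    have s1 : sg true = 1 := by simp [sg]
    have s2 : sg false = -1 := by simp [sg]
    rw [s1, s2]
    by_cases hc : G 0 (x (Fin.cons false σ)) ≤ G 0 (x (Fin.cons true σ))
    · simp only [u, v, hc, if_true]
      rw [abs_of_nonneg (by linarith)] at h1
      linarith
    · simp only [u, v, hc, if_false]
      rw [abs_of_nonpos (by linarith)] at h1
      linarith

theorem aux_EK {ι : Type*} [Fintype ι] [DecidableEq ι] {s : ℕ} (A : Fin s → Matrix ι ι ℝ)
    (hA : ∀ t, (A t)ᵀ = A t) (z : ι → ℝ) (V : ℝ) (hV0 : 0 ≤ V)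
    (hz : ∑ t, A t * A t = Matrix.diagonal z)
    (hV : ∀ a, z a ≤ V) (P : ℕ) (hP : P ≠ 0) (hcard : (Fintype.card ι : ℝ) ≤ Real.exp P)
    (K : (Fin s → Bool) → ℝ) (hK0 : ∀ σ, 0 ≤ K σ)
    (hK : ∀ σ, K σ ^ (2 * P) = (radM A σ ^ (2 * P)).trace) (c : ℝ) (hc : 0 < c) :
    (1 / 2 ^ s) * ∑ σ, K σ ≤ (6 * P * V / c + c) / 2 := by
  set a := (1 / 2 ^ s) * ∑ σ, K σ with ha
  have h1 : a ^ (2 * P) ≤ (1 / 2 ^ s) * ∑ σ, K σ ^ (2 * P) := by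
    rw [ha, Finset.mul_sum, Finset.mul_sum]
    refine Real.pow_arith_mean_le_arith_mean_pow _ (fun _ => (1 : ℝ) / 2 ^ s) _ (fun _ _ => by positivity) ?_ (fun σ _ => hK0 σ) _
    simp
  simp only [hK] at h1
  have h2 := aux_khin A hA z V hV0 hz hV P P le_rfl
  have h3 : a ^ (2 * P) ≤ (2 * P * V) ^ P * Fintype.card ι := by
    refine h1.trans ?_
    calc _ ≤ (1 / 2 ^ s : ℝ) * ((2 * P * V) ^ P * (2 ^ s * Fintype.card ι)) := by gcongr
      _ = _ := by field_simp
  have h4 : (a ^ 2) ^ P ≤ (6 * P * V) ^ P := by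
    rw [← pow_mul]
    refine h3.trans ?_
    have e1 : Real.exp P ≤ 3 ^ P := by
      have : Real.exp P = Real.exp 1 ^ P := by rw [← Real.exp_nat_mul]; simp
      rw [this]
      gcongr
      exact Real.exp_one_lt_three.le
    calc _ ≤ (2 * P * V) ^ P * 3 ^ P := by gcongr; exact hcard.trans e1
      _ = _ := by rw [← mul_pow]; ring_nf
  have h5 : a ^ 2 ≤ 6 * P * V := (pow_le_pow_iff_left₀ (by positivity) (by positivity) hP).1 h4
  have h6 : a ^ 2 / c ≤ 6 * P * V / c := by gcongr
  have h7 : 2 * a ≤ a ^ 2 / c + c := by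
    have : a ^ 2 / c + c - 2 * a = (a - c) ^ 2 / c := by field_simp; ring
    have : 0 ≤ (a - c) ^ 2 / c := by positivity
    linarith
  linarith

theorem Es_prod {n m s : ℕ} (p : Matrix (Fin n) (Fin m) ℝ) (g : Fin s → Fin n × Fin m → ℝ) :
    Esample s p (fun S => ∏ t, g t (S t)) = ∏ t, ∑ a : Fin n × Fin m, p a.1 a.2 * g t a := by
  rw [Finset.prod_univ_sum, Fintype.piFinset_univ, Esample]
  refine Finset.sum_congr rfl fun S _ => ?_
  rw [sampleProb, ← Finset.prod_mul_distrib]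

theorem Es_sum1 {n m : ℕ} {p : Matrix (Fin n) (Fin m) ℝ} (hp : IsDistrib p) :
    ∑ a : Fin n × Fin m, p a.1 a.2 = 1 := by
  rw [Fintype.sum_prod_type]; exact hp.2

theorem Es_one {n m s : ℕ} {p : Matrix (Fin n) (Fin m) ℝ} (hp : IsDistrib p) (c : ℝ) :
    Esample s p (fun _ => c) = c := by
  have h := Es_prod (s := s) p (fun _ _ => 1)
  simp only [Finset.prod_const_one, mul_one, Es_sum1 hp] at h
  rw [Esample] at h ⊢
  simp only [mul_one] at h
  rw [← Finset.sum_mul, h, one_mul]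

theorem Es_single {n m s : ℕ} {p : Matrix (Fin n) (Fin m) ℝ} (hp : IsDistrib p) (t : Fin s)
    (g : Fin n × Fin m → ℝ) :
    Esample s p (fun S => g (S t)) = ∑ a : Fin n × Fin m, p a.1 a.2 * g a := by
  have h := Es_prod (s := s) p (fun u a => if u = t then g a else 1)
  have h1 : ∀ u : Fin s, ∑ a : Fin n × Fin m, p a.1 a.2 * (if u = t then g a else 1)
      = if u = t then ∑ a : Fin n × Fin m, p a.1 a.2 * g a else 1 := by
    intro u; by_cases hu : u = t
    · simp [hu]
    · simp [hu, Es_sum1 hp]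
  simp only [h1] at h
  simpa using h

theorem Es_mono {n m s : ℕ} {p : Matrix (Fin n) (Fin m) ℝ} (hp : IsDistrib p)
    {f g : (Fin s → Fin n × Fin m) → ℝ} (h : ∀ S, f S ≤ g S) : Esample s p f ≤ Esample s p g :=
  Finset.sum_le_sum fun S _ => mul_le_mul_of_nonneg_left (h S)
    (Finset.prod_nonneg fun t _ => hp.1 _ _)

theorem Es_add {n m s : ℕ} (p : Matrix (Fin n) (Fin m) ℝ)
    (f g : (Fin s → Fin n × Fin m) → ℝ) :
    Esample s p (fun S => f S + g S) = Esample s p f + Esample s p g := by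
  simp only [Esample, mul_add, Finset.sum_add_distrib]

theorem Es_mul {n m s : ℕ} (p : Matrix (Fin n) (Fin m) ℝ) (c : ℝ)
    (f : (Fin s → Fin n × Fin m) → ℝ) :
    Esample s p (fun S => c * f S) = c * Esample s p f := by
  simp only [Esample, Finset.mul_sum]
  exact Finset.sum_congr rfl fun S _ => by ring

theorem Es_sum {n m s : ℕ} (p : Matrix (Fin n) (Fin m) ℝ) {κ : Type*} (I : Finset κ)
    (f : κ → (Fin s → Fin n × Fin m) → ℝ) :
    Esample s p (fun S => ∑ k ∈ I, f k S) = ∑ k ∈ I, Esample s p (f k) := by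
  simp only [Esample, Finset.mul_sum]
  exact Finset.sum_comm

theorem aux_chernoff {n m s : ℕ} {p : Matrix (Fin n) (Fin m) ℝ} (hp : IsDistrib p)
    (f : Fin n × Fin m → ℝ) (B ν : ℝ) (hB : 0 < B) (hf0 : ∀ a, 0 ≤ f a) (hf : ∀ a, f a ≤ B)
    (hν : ∑ a : Fin n × Fin m, p a.1 a.2 * f a ≤ ν) :
    Esample s p (fun S => Real.exp ((∑ t, f (S t)) / B)) ≤ Real.exp (2 * s * ν / B) := by
  have h : ∀ S : Fin s → Fin n × Fin m, Real.exp ((∑ t, f (S t)) / B)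
      = ∏ t, Real.exp (f (S t) / B) := by
    intro S; rw [Finset.sum_div, Real.exp_sum]
  simp only [h]
  rw [Es_prod p (fun _ a => Real.exp (f a / B)), Finset.prod_const, Finset.card_univ,
    Fintype.card_fin]
  have h1 : ∑ a : Fin n × Fin m, p a.1 a.2 * Real.exp (f a / B) ≤ 1 + 2 * ν / B := by
    calc _ ≤ ∑ a : Fin n × Fin m, (p a.1 a.2 + 2 / B * (p a.1 a.2 * f a)) := by
          refine Finset.sum_le_sum fun a _ => ?_
          have hx0 : 0 ≤ f a / B := div_nonneg (hf0 a) hB.le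
          have hx : |f a / B| ≤ 1 := by
            rw [abs_of_nonneg hx0]; exact (div_le_one hB).2 (hf a)
          have h2 := (le_abs_self _).trans (Real.abs_exp_sub_one_le hx)
          rw [abs_of_nonneg hx0] at h2
          have h3 : Real.exp (f a / B) ≤ 1 + 2 * (f a / B) := by linarith
          refine (mul_le_mul_of_nonneg_left h3 (hp.1 a.1 a.2)).trans (le_of_eq ?_)
          field_simp
      _ = 1 + 2 / B * ∑ a : Fin n × Fin m, p a.1 a.2 * f a := by
          rw [Finset.sum_add_distrib, Es_sum1 hp, Finset.mul_sum]
      _ ≤ 1 + 2 / B * ν := by gcongr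
      _ = _ := by ring
  have h0 : 0 ≤ ∑ a : Fin n × Fin m, p a.1 a.2 * Real.exp (f a / B) :=
    Finset.sum_nonneg fun a _ => mul_nonneg (hp.1 _ _) (Real.exp_pos _).le
  have h2 : 1 + 2 * ν / B ≤ Real.exp (2 * ν / B) := by
    have := Real.add_one_le_exp (2 * ν / B); linarith
  calc _ ≤ Real.exp (2 * ν / B) ^ s := pow_le_pow_left₀ h0 (h1.trans h2) s
    _ = _ := by rw [← Real.exp_nat_mul]; congr 1; ring

/-- Soft maximum bound. -/
theorem aux_max {n m s : ℕ} {p : Matrix (Fin n) (Fin m) ℝ} (hp : IsDistrib p)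
    {ι : Type*} [Fintype ι] [Nonempty ι]
    (f : ι → Fin n × Fin m → ℝ) (B ν : ℝ) (hB : 0 < B) (hf0 : ∀ k a, 0 ≤ f k a)
    (hf : ∀ k a, f k a ≤ B)
    (hν : ∀ k, ∑ a : Fin n × Fin m, p a.1 a.2 * f k a ≤ ν) :
    ∃ V : (Fin s → Fin n × Fin m) → ℝ, (∀ S k, ∑ t, f k (S t) ≤ V S) ∧
      Esample s p V ≤ B * Real.log (Fintype.card ι) + 2 * s * ν := by
  set d : ℝ := (Fintype.card ι : ℝ) with hd
  have hd0 : 0 < d := by rw [hd]; exact_mod_cast Fintype.card_pos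
  set a := d * Real.exp (2 * s * ν / B) with ha
  have ha0 : 0 < a := by positivity
  refine ⟨fun S => B * (Real.log a - 1) + B / a * ∑ k, Real.exp ((∑ t, f k (S t)) / B), ?_, ?_⟩
  · intro S k
    set E := ∑ k, Real.exp ((∑ t, f k (S t)) / B) with hE
    have h1 : Real.exp ((∑ t, f k (S t)) / B) ≤ E :=
      Finset.single_le_sum (f := fun k => Real.exp ((∑ t, f k (S t)) / B))
        (fun _ _ => (Real.exp_pos _).le) (Finset.mem_univ k)
    have hE0 : 0 < E := (Real.exp_pos _).trans_le h1
    have h2 : (∑ t, f k (S t)) / B ≤ Real.log E := (Real.le_log_iff_exp_le hE0).2 h1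
    have h3 : Real.log (E / a) ≤ E / a - 1 := Real.log_le_sub_one_of_pos (by positivity)
    rw [Real.log_div hE0.ne' ha0.ne'] at h3
    have h4 : (∑ t, f k (S t)) / B ≤ Real.log a - 1 + E / a := by linarith
    rw [div_le_iff₀ hB] at h4
    refine h4.trans (le_of_eq ?_)
    ring
  · rw [Es_add, Es_one hp, Es_mul, Es_sum]
    have h1 : ∑ k, Esample s p (fun S => Real.exp ((∑ t, f k (S t)) / B)) ≤ a := by
      calc _ ≤ ∑ k : ι, Real.exp (2 * s * ν / B) :=
            Finset.sum_le_sum fun k _ => aux_chernoff hp (f k) B ν hB (hf0 k) (hf k) (hν k)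
        _ = a := by rw [Finset.sum_const, nsmul_eq_mul, Finset.card_univ]
    have h2 : B / a * ∑ k, Esample s p (fun S => Real.exp ((∑ t, f k (S t)) / B)) ≤ B := by
      calc _ ≤ B / a * a := by gcongr
        _ = B := by field_simp
    have h3 : Real.log a = Real.log d + 2 * s * ν / B := by
      rw [ha, Real.log_mul hd0.ne' (Real.exp_pos _).ne', Real.log_exp]
    have h4 : B * (Real.log a - 1) = B * Real.log d + 2 * s * ν - B := by
      rw [h3]; field_simp
    linarith

theorem aux_block {n m : ℕ} (X : Matrix (Fin n ⊕ Fin m) (Fin n ⊕ Fin m) ℝ) (hX : Xᵀ = X)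
    (P : ℕ) (hP : P ≠ 0) (K : ℝ) (hK : K ^ (2 * P) = (X ^ (2 * P)).trace)
    (v : Fin m → ℝ) (hv : v ⬝ᵥ v = 1) :
    (X.toBlocks₁₂ *ᵥ v) ⬝ᵥ (X.toBlocks₁₂ *ᵥ v) ≤ K ^ 2 := by
  have h1 := aux_norm X hX (Sum.elim 0 v) (by simpa [dotProduct] using hv) P
  rw [← hK, pow_mul] at h1
  have h2 := (pow_le_pow_iff_left₀ (by
    simp only [dotProduct]; exact Finset.sum_nonneg fun _ _ => mul_self_nonneg _)
    (sq_nonneg K) hP).1 h1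
  refine le_trans ?_ h2
  simp only [dotProduct, Fintype.sum_sum_type]
  refine le_add_of_le_of_nonneg (le_of_eq ?_) (Finset.sum_nonneg fun _ _ => mul_self_nonneg _)
  simp [Matrix.mulVec, dotProduct, Fintype.sum_sum_type, Matrix.toBlocks₁₂]

def dil {n m : ℕ} (w : Fin n × Fin m → ℝ) (a : Fin n × Fin m) :
    Matrix (Fin n ⊕ Fin m) (Fin n ⊕ Fin m) ℝ :=
  Matrix.fromBlocks 0 (Matrix.single a.1 a.2 (w a)) (Matrix.single a.2 a.1 (w a)) 0

def dilf {n m : ℕ} (w : Fin n × Fin m → ℝ) (k : Fin n ⊕ Fin m) (a : Fin n × Fin m) : ℝ :=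
  Sum.elim (fun i => if a.1 = i then w a ^ 2 else 0) (fun j => if a.2 = j then w a ^ 2 else 0) k

theorem dil_symm {n m : ℕ} (w : Fin n × Fin m → ℝ) (a : Fin n × Fin m) :
    (dil w a)ᵀ = dil w a := by
  simp [dil, Matrix.fromBlocks_transpose, Matrix.transpose_single]

theorem dil_sq {n m : ℕ} (w : Fin n × Fin m → ℝ) (a : Fin n × Fin m) :
    dil w a * dil w a = Matrix.diagonal (fun k => dilf w k a) := by
  rw [dil, Matrix.fromBlocks_multiply]
  ext (i | i) (j | j)
  · simp only [Matrix.fromBlocks_apply₁₁, Matrix.zero_mul, zero_add, Matrix.single_mul_single_same,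
      Matrix.single_apply, Matrix.diagonal_apply, dilf, Sum.elim_inl, Sum.inl.injEq]
    by_cases h : a.1 = i
    · subst h; simp [sq]
    · simp [h]
  · simp
  · simp
  · simp only [Matrix.fromBlocks_apply₂₂, Matrix.zero_mul, add_zero, Matrix.single_mul_single_same,
      Matrix.single_apply, Matrix.diagonal_apply, dilf, Sum.elim_inr, Sum.inr.injEq]
    by_cases h : a.2 = i
    · subst h; simp [sq]
    · simp [h]

theorem aux_lin {n m s : ℕ} (w : Fin n × Fin m → ℝ) (S : Fin s → Fin n × Fin m)
    (σ : Fin s → Bool) (Z : Matrix (Fin n) (Fin m) ℝ) :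
    ∑ i, ∑ j, (radM (fun t => dil w (S t)) σ).toBlocks₁₂ i j * Z i j
      = ∑ t, sg (σ t) * (w (S t) * Z (S t).1 (S t).2) := by
  have h : ∀ i j, (radM (fun t => dil w (S t)) σ).toBlocks₁₂ i j
      = ∑ t, sg (σ t) * (if (S t).1 = i ∧ (S t).2 = j then w (S t) else 0) := by
    intro i j
    simp [radM, Matrix.toBlocks₁₂, Matrix.sum_apply, dil, Matrix.single_apply]
  simp only [h, Finset.sum_mul]
  calc _ = ∑ i, ∑ t, ∑ j, sg (σ t) * (if (S t).1 = i ∧ (S t).2 = j then w (S t) else 0) * Z i j :=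
        Finset.sum_congr rfl fun i _ => Finset.sum_comm
    _ = ∑ t, ∑ i, ∑ j, sg (σ t) * (if (S t).1 = i ∧ (S t).2 = j then w (S t) else 0) * Z i j :=
        Finset.sum_comm
    _ = _ := by
        refine Finset.sum_congr rfl fun t _ => ?_
        rw [Finset.sum_eq_single (S t).1, Finset.sum_eq_single (S t).2]
        · simp; ring
        · intro j _ hj; simp [hj.symm]
        · simp
        · intro i _ hi; simp [hi.symm]
        · simp

theorem aux_fixed {n m s : ℕ} (hs : 1 ≤ s) (pr : Fin n → ℝ) (pc : Fin m → ℝ) (r l b : ℝ)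
    (hl : 0 ≤ l) (hb : 0 ≤ b)
    (ℓ : ℝ → ℝ → ℝ) (Y : Matrix (Fin n) (Fin m) ℝ) (hL : LipLoss l ℓ)
    (hℓ : ∀ x y, 0 ≤ ℓ x y ∧ ℓ x y ≤ b)
    (w bad : Fin n × Fin m → ℝ) (hbad : ∀ a, bad a = 0 ∨ bad a = 1)
    (hw : ∀ a, w a * (Real.sqrt (pr a.1) * Real.sqrt (pc a.2)) = 1 - bad a)
    (S : Fin s → Fin n × Fin m) (V : ℝ) (hV0 : 0 ≤ V) (hV : ∀ k, ∑ t, dilf w k (S t) ≤ V)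
    (P : ℕ) (hP : P ≠ 0) (hnm : (n : ℝ) + m ≤ Real.exp P) (c : ℝ) (hc : 0 < c) :
    rademacherLoss ℓ Y S (Wball pr pc r)
      ≤ l * Real.sqrt r / s * ((6 * P * V / c + c) / 2) + b / s * ∑ t, bad (S t) := by
  set A : Fin s → Matrix (Fin n ⊕ Fin m) (Fin n ⊕ Fin m) ℝ := fun t => dil w (S t) with hA
  have hAs : ∀ t, (A t)ᵀ = A t := fun t => dil_symm w (S t)
  have hs0 : (0 : ℝ) < s := by exact_mod_cast hs
  let K : (Fin s → Bool) → ℝ := fun σ => ((radM A σ ^ (2 * P)).trace) ^ ((1 : ℝ) / ((2 * P : ℕ) : ℝ))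
  have htr : ∀ σ, 0 ≤ (radM A σ ^ (2 * P)).trace := fun σ =>
    aux_trace_nonneg _ (radM_symm A hAs σ) P
  have hK0 : ∀ σ, 0 ≤ K σ := fun σ => Real.rpow_nonneg (htr σ) _
  have hK : ∀ σ, K σ ^ (2 * P) = (radM A σ ^ (2 * P)).trace := by
    intro σ
    simp only [K, one_div]
    exact Real.rpow_inv_natCast_pow (htr σ) (by omega)
  have hsq : ∑ t, A t * A t = Matrix.diagonal (fun k => ∑ t, dilf w k (S t)) := by
    simp only [hA, dil_sq]
    ext i j
    rw [Matrix.sum_apply]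
    by_cases h : i = j
    · subst h; simp
    · simp [h]
  have hEK := aux_EK A hAs _ V hV0 hsq hV P hP (by simpa using hnm) K hK0 hK c hc
  have hlin : ∀ σ, ∀ X ∈ Wball pr pc r,
      ∑ t, sg (σ t) * (l * ((1 - bad (S t)) * X (S t).1 (S t).2)) ≤ l * (K σ * Real.sqrt r) := by
    intro σ X hX
    have h1 := aux_dual (radM A σ).toBlocks₁₂
      (Matrix.diagonal (fun i => Real.sqrt (pr i)) * X * Matrix.diagonal (fun j => Real.sqrt (pc j)))
      (K σ) (hK0 σ) (fun v hv => aux_block _ (radM_symm A hAs σ) P hP (K σ) (hK σ) v hv)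
    rw [aux_lin] at h1
    have h2 : traceNorm (Matrix.diagonal (fun i => Real.sqrt (pr i)) * X *
      Matrix.diagonal (fun j => Real.sqrt (pc j))) ≤ Real.sqrt r := hX
    have h3 := h1.trans (mul_le_mul_of_nonneg_left h2 (hK0 σ))
    have h4 := mul_le_mul_of_nonneg_left h3 hl
    refine le_trans (le_of_eq ?_) h4
    rw [Finset.mul_sum]
    refine Finset.sum_congr rfl fun t _ => ?_
    rw [Matrix.mul_diagonal, Matrix.diagonal_mul, ← hw]
    ring
  by_cases hne : (Wball pr pc r).Nonempty
  swap
  · rw [Set.not_nonempty_iff_eq_empty] at hne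
    have : rademacherLoss ℓ Y S (Wball pr pc r) = 0 := by
      rw [hne, rademacherLoss]; simp
    rw [this]
    have : 0 ≤ ∑ t, bad (S t) := Finset.sum_nonneg fun t _ => by
      rcases hbad (S t) with h | h <;> rw [h] <;> norm_num
    positivity
  refine le_of_forall_pos_le_add fun ε hε => ?_
  have hch : ∀ σ : Fin s → Bool, ∃ X : Wball pr pc r,
      sSup ((fun X : Matrix (Fin n) (Fin m) ℝ => (1 / (s : ℝ)) *
      ∑ t, (if σ t then (1 : ℝ) else -1) *
        ℓ (X (S t).1 (S t).2) (Y (S t).1 (S t).2)) '' (Wball pr pc r)) ≤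
      (1 / (s : ℝ)) * ∑ t, sg (σ t) * ℓ (X.1 (S t).1 (S t).2) (Y (S t).1 (S t).2) + ε := by
    intro σ
    obtain ⟨_, ⟨X, hX, rfl⟩, h⟩ := exists_lt_of_lt_csSup (hne.image _) (sub_lt_self _ hε)
    refine ⟨⟨X, hX⟩, ?_⟩
    have := (sub_lt_iff_lt_add.1 h).le
    exact this
  choose x hx using hch
  have hcon := aux_contr (T := Wball pr pc r) s
    (fun t X => (1 - bad (S t)) * ℓ (X.1 (S t).1 (S t).2) (Y (S t).1 (S t).2))
    (fun t X => l * ((1 - bad (S t)) * X.1 (S t).1 (S t).2)) (fun _ => 0)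
    (by
      intro t X X'
      rcases hbad (S t) with h | h
      · simp only [h, sub_zero, one_mul]
        rw [← mul_sub, abs_mul, abs_of_nonneg hl]
        exact hL _ _ _
      · simp [h])
    (fun σ => l * (K σ * Real.sqrt r))
    (by intro σ X; rw [zero_add]; exact hlin σ X.1 X.2) x
  simp only [zero_add] at hcon
  have hpt : ∀ σ : Fin s → Bool,
      sSup ((fun X : Matrix (Fin n) (Fin m) ℝ => (1 / (s : ℝ)) *
      ∑ t, (if σ t then (1 : ℝ) else -1) *
        ℓ (X (S t).1 (S t).2) (Y (S t).1 (S t).2)) '' (Wball pr pc r)) ≤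
      (1 / (s : ℝ)) * ∑ t, sg (σ t) * ((1 - bad (S t)) *
        ℓ ((x σ).1 (S t).1 (S t).2) (Y (S t).1 (S t).2)) + (b / s * ∑ t, bad (S t) + ε) := by
    intro σ
    refine (hx σ).trans ?_
    rw [← add_assoc]
    refine add_le_add_left ?_ ε
    have : b / s * ∑ t, bad (S t) = 1 / s * ∑ t, b * bad (S t) := by
      rw [← Finset.mul_sum]; ring
    rw [this, ← mul_add, ← Finset.sum_add_distrib]
    refine mul_le_mul_of_nonneg_left (Finset.sum_le_sum fun t _ => ?_) (by positivity)
    obtain ⟨l1, l2⟩ := hℓ ((x σ).1 (S t).1 (S t).2) (Y (S t).1 (S t).2)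
    rcases hbad (S t) with h | h
    · simp [h]
    · rw [h]
      cases σ t <;> simp [sg] <;> linarith
  rw [rademacherLoss]
  have h2s : (0 : ℝ) < 1 / 2 ^ s := by positivity
  calc _ ≤ (1 / 2 ^ s) * ∑ σ : Fin s → Bool, ((1 / (s : ℝ)) * ∑ t, sg (σ t) * ((1 - bad (S t)) *
        ℓ ((x σ).1 (S t).1 (S t).2) (Y (S t).1 (S t).2)) + (b / s * ∑ t, bad (S t) + ε)) :=
        mul_le_mul_of_nonneg_left (Finset.sum_le_sum fun σ _ => hpt σ) h2s.le
    _ = (1 / 2 ^ s) * ((1 / (s : ℝ)) * ∑ σ : Fin s → Bool, ∑ t, sg (σ t) * ((1 - bad (S t)) *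
        ℓ ((x σ).1 (S t).1 (S t).2) (Y (S t).1 (S t).2))) + (b / s * ∑ t, bad (S t) + ε) := by
        rw [Finset.sum_add_distrib, ← Finset.mul_sum, mul_add]
        congr 1
        simp only [Finset.sum_const, Finset.card_univ, Fintype.card_fun, Fintype.card_bool,
          Fintype.card_fin, nsmul_eq_mul, Nat.cast_pow, Nat.cast_ofNat]
        rw [← mul_assoc, one_div, inv_mul_cancel₀ (by positivity), one_mul]
    _ ≤ (1 / 2 ^ s) * ((1 / (s : ℝ)) * ∑ σ, l * (K σ * Real.sqrt r)) +
          (b / s * ∑ t, bad (S t) + ε) := by gcongr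
    _ = l * Real.sqrt r / s * ((1 / 2 ^ s) * ∑ σ, K σ) + (b / s * ∑ t, bad (S t) + ε) := by
        rw [← Finset.mul_sum, ← Finset.sum_mul]; ring
    _ ≤ l * Real.sqrt r / s * ((6 * P * V / c + c) / 2) + (b / s * ∑ t, bad (S t) + ε) := by
        gcongr
    _ = _ := by ring

theorem aux_trivial {n m s : ℕ} (hs : 1 ≤ s) (b : ℝ) (hb : 0 ≤ b)
    (ℓ : ℝ → ℝ → ℝ) (Y : Matrix (Fin n) (Fin m) ℝ)
    (hℓ : ∀ x y, 0 ≤ ℓ x y ∧ ℓ x y ≤ b) (S : Fin s → Fin n × Fin m)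
    (W : Set (Matrix (Fin n) (Fin m) ℝ)) : rademacherLoss ℓ Y S W ≤ b := by
  have hs0 : (0 : ℝ) < s := by exact_mod_cast hs
  rw [rademacherLoss]
  calc _ ≤ (1 / 2 ^ s : ℝ) * ∑ σ : Fin s → Bool, b := by
        refine mul_le_mul_of_nonneg_left (Finset.sum_le_sum fun σ _ => ?_) (by positivity)
        refine Real.sSup_le ?_ hb
        rintro _ ⟨X, _, rfl⟩
        calc _ ≤ (1 / (s : ℝ)) * ∑ t : Fin s, b := by
              refine mul_le_mul_of_nonneg_left (Finset.sum_le_sum fun t _ => ?_) (by positivity)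
              obtain ⟨l1, l2⟩ := hℓ (X (S t).1 (S t).2) (Y (S t).1 (S t).2)
              cases σ t <;> simp <;> linarith
          _ = b := by simp; field_simp
    _ = b := by simp

theorem aux_badrow {n : ℕ} (hn : 0 < n) (τ : ℝ) (hτ : 0 < τ) {k : ℕ}
    (hkn : k ≤ n) (q' : Fin k → ℝ) :
    ∑ i, q' i * (if τ / n ≤ q' i then (0 : ℝ) else 1) ≤ τ := by
  have hn0 : (0 : ℝ) < n := by exact_mod_cast hn
  calc _ ≤ ∑ i : Fin k, τ / n := by
        refine Finset.sum_le_sum fun i _ => ?_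
        split_ifs with h
        · simp; positivity
        · simp; exact (not_le.1 h).le
    _ = k * (τ / n) := by simp
    _ ≤ n * (τ / n) := by gcongr
    _ = τ := by field_simp

set_option maxHeartbeats 1000000 in
/-- for an arbitrary sampling distribution and an `l`-Lipschitz loss bounded
by `b`, the expected empirical Rademacher complexity of the loss class `ℓ ∘ W_p` is at most
`C·(l+b)·(r n log n / s)^{1/3}`. -/
theorem expected_rademacher_loss_class_cubeRoot :
    ∃ C : ℝ, 0 < C ∧
      ∀ (n m s : ℕ) (r l b : ℝ) (p : Matrix (Fin n) (Fin m) ℝ)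
        (ℓ : ℝ → ℝ → ℝ) (Y : Matrix (Fin n) (Fin m) ℝ),
        2 ≤ m → m ≤ n → 1 ≤ r → 0 ≤ l → 0 ≤ b → 1 ≤ s →
        IsDistrib p →
        LipLoss l ℓ →
        (∀ x y, 0 ≤ ℓ x y ∧ ℓ x y ≤ b) →
        Esample s p
            (fun S => rademacherLoss ℓ Y S (Wball (rowMarg p) (colMarg p) r)) ≤
          C * (l + b) * (r * n * Real.log n / s) ^ ((1 : ℝ) / 3) := by
  refine ⟨10, by norm_num, ?_⟩
  intro n m s r l b p ℓ Y hm hmn hr hl hb hs hp hL hℓ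
  have hs0 : (0 : ℝ) < s := by exact_mod_cast hs
  have hn2 : (2 : ℝ) ≤ n := by exact_mod_cast hm.trans hmn
  have hmn' : (m : ℝ) ≤ n := by exact_mod_cast hmn
  have hn0 : (0 : ℝ) < n := by linarith
  have hlog2 : 0.69 < Real.log 2 := by have := Real.log_two_gt_d9; linarith
  have hlog : Real.log 2 ≤ Real.log n := Real.log_le_log (by norm_num) hn2
  set Λ := Real.log n with hΛ
  have hΛ0 : 0 < Λ := by linarith
  set y := r * n * Λ / s with hy
  have hy0 : 0 < y := by positivity
  set τ := y ^ ((1 : ℝ) / 3) with hτ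
  have hτ0 : 0 < τ := Real.rpow_pos_of_pos hy0 _
  have hτ3 : τ ^ 3 = y := by
    rw [hτ, ← Real.rpow_natCast, ← Real.rpow_mul hy0.le]; norm_num
  rcases lt_or_ge 1 y with hy1 | hy1
  · have h1 : 1 ≤ τ := Real.one_le_rpow hy1.le (by norm_num)
    refine (Es_mono hp (fun S => aux_trivial hs b hb ℓ Y hℓ S _)).trans ?_
    rw [Es_one hp]
    nlinarith [mul_nonneg hl hτ0.le, mul_le_mul_of_nonneg_left h1 hb]
  have hτ1 : τ ≤ 1 := Real.rpow_le_one hy0.le hy1 (by norm_num)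
  set pr := rowMarg p with hpr
  set pc := colMarg p with hpc
  have hpr0 : ∀ i, 0 ≤ pr i := fun i => Finset.sum_nonneg fun j _ => hp.1 i j
  have hpc0 : ∀ j, 0 ≤ pc j := fun j => Finset.sum_nonneg fun i _ => hp.1 i j
  set θ := τ / n with hθ
  have hθ0 : 0 < θ := by positivity
  let bad : Fin n × Fin m → ℝ := fun a => if θ ≤ pr a.1 ∧ θ ≤ pc a.2 then 0 else 1
  let w : Fin n × Fin m → ℝ := fun a =>
    if θ ≤ pr a.1 ∧ θ ≤ pc a.2 then 1 / (Real.sqrt (pr a.1) * Real.sqrt (pc a.2)) else 0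
  have hbad : ∀ a, bad a = 0 ∨ bad a = 1 := by
    intro a; simp only [bad]; split_ifs <;> simp
  have hw : ∀ a, w a * (Real.sqrt (pr a.1) * Real.sqrt (pc a.2)) = 1 - bad a := by
    intro a
    simp only [w, bad]
    split_ifs with h
    · have h1 : 0 < Real.sqrt (pr a.1) := Real.sqrt_pos.2 (hθ0.trans_le h.1)
      have h2 : 0 < Real.sqrt (pc a.2) := Real.sqrt_pos.2 (hθ0.trans_le h.2)
      field_simp; simp
    · simp
  have hw2 : ∀ a, w a ^ 2 = if θ ≤ pr a.1 ∧ θ ≤ pc a.2 then 1 / (pr a.1 * pc a.2) else 0 := by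
    intro a
    simp only [w]
    split_ifs with h
    · rw [div_pow, mul_pow, Real.sq_sqrt (hpr0 _), Real.sq_sqrt (hpc0 _), one_pow]
    · simp
  have hw2r : ∀ a, w a ^ 2 ≤ 1 / θ / pr a.1 := by
    intro a
    rw [hw2]
    split_ifs with h
    · rw [div_div]
      have := hθ0.trans_le h.1
      rw [mul_comm]
      gcongr
      exact h.2
    · have := hpr0 a.1
      positivity
  have hw2c : ∀ a, w a ^ 2 ≤ 1 / θ / pc a.2 := by
    intro a
    rw [hw2]
    split_ifs with h
    · rw [div_div]
      have := hθ0.trans_le h.2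
      gcongr
      exact h.1
    · have := hpc0 a.2
      positivity
  have hw2B : ∀ a, w a ^ 2 ≤ 1 / θ / θ := by
    intro a
    rw [hw2]
    split_ifs with h
    · rw [div_div]
      have := hθ0.trans_le h.2
      gcongr
      exacts [hpr0 _, h.1, h.2]
    · positivity
  have hf0 : ∀ k a, 0 ≤ dilf w k a := by
    rintro (k | k) a <;> simp only [dilf, Sum.elim_inl, Sum.elim_inr] <;> split_ifs <;> positivity
  have hfB : ∀ k a, dilf w k a ≤ 1 / θ / θ := by
    rintro (k | k) a <;> simp only [dilf, Sum.elim_inl, Sum.elim_inr] <;> split_ifs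
    · exact hw2B a
    · positivity
    · exact hw2B a
    · positivity
  have hν : ∀ k, ∑ a : Fin n × Fin m, p a.1 a.2 * dilf w k a ≤ 1 / θ := by
    rintro (k | k)
    · rw [Fintype.sum_prod_type, Finset.sum_eq_single k]
      · simp only [dilf, Sum.elim_inl, if_true]
        calc _ ≤ ∑ j, p k j * (1 / θ / pr k) :=
              Finset.sum_le_sum fun j _ => mul_le_mul_of_nonneg_left (hw2r (k, j)) (hp.1 k j)
          _ = 1 / θ * (pr k / pr k) := by
              rw [← Finset.sum_mul]
              change pr k * _ = _
              ring
          _ ≤ 1 / θ * 1 := by gcongr; exact div_self_le_one _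
          _ = 1 / θ := mul_one _
      · intro i _ hi; simp [dilf, hi]
      · simp
    · rw [Fintype.sum_prod_type_right, Finset.sum_eq_single k]
      · simp only [dilf, Sum.elim_inr, if_true]
        calc _ ≤ ∑ i, p i k * (1 / θ / pc k) :=
              Finset.sum_le_sum fun i _ => mul_le_mul_of_nonneg_left (hw2c (i, k)) (hp.1 i k)
          _ = 1 / θ * (pc k / pc k) := by
              rw [← Finset.sum_mul]
              change pc k * _ = _
              ring
          _ ≤ 1 / θ * 1 := by gcongr; exact div_self_le_one _
          _ = 1 / θ := mul_one _
      · intro i _ hi; simp [dilf, hi]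
      · simp
  have hn1 : 0 < n := by omega
  have : Nonempty (Fin n ⊕ Fin m) := ⟨Sum.inl ⟨0, hn1⟩⟩
  obtain ⟨V, hV, hEV⟩ := aux_max (s := s) hp (dilf w) (1 / θ / θ) (1 / θ) (by positivity) hf0 hfB hν
  have hV0 : ∀ S, 0 ≤ V S := fun S =>
    (Finset.sum_nonneg fun t _ => hf0 (Sum.inl ⟨0, hn1⟩) (S t)).trans (hV S (Sum.inl ⟨0, hn1⟩))
  have hcard : ((Fintype.card (Fin n ⊕ Fin m) : ℕ) : ℝ) = n + m := by simp
  have hlogd : Real.log ((n : ℝ) + m) ≤ 2 * Λ := by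
    have : Real.log ((n : ℝ) + m) ≤ Real.log (2 * n) :=
      Real.log_le_log (by positivity) (by linarith)
    rw [Real.log_mul (by norm_num) hn0.ne'] at this
    linarith
  rw [hcard] at hEV
  set P := ⌈2 * Λ⌉₊ with hP
  have hP1 : 2 * Λ ≤ P := Nat.le_ceil _
  have hP2 : (P : ℝ) ≤ 4 * Λ := by
    have := Nat.ceil_lt_add_one (a := 2 * Λ) (by positivity)
    linarith
  have hPne : P ≠ 0 := by
    intro h; rw [h] at hP1; push_cast at hP1; linarith
  have hnm : (n : ℝ) + m ≤ Real.exp P := by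
    rw [← Real.log_le_iff_le_exp (by positivity)]; linarith
  have hEV2 : Esample s p V ≤ 4 * s * n / τ := by
    refine hEV.trans ?_
    have hyy : r * n * Λ = τ ^ 3 * s := by rw [hτ3, hy]; field_simp
    have hnL : n * Λ ≤ τ ^ 3 * s := by
      rw [← hyy]; nlinarith [mul_pos hn0 hΛ0]
    have h1 : 1 / θ / θ * Real.log ((n : ℝ) + m) ≤ 1 / θ / θ * (2 * Λ) := by gcongr
    have h2 : 1 / θ / θ * (2 * Λ) = 2 * (n / τ ^ 2) * (n * Λ) := by rw [hθ]; field_simp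
    have h3 : 2 * (n / τ ^ 2) * (n * Λ) ≤ 2 * (n / τ ^ 2) * (τ ^ 3 * s) := by gcongr
    have h4 : 2 * (n / τ ^ 2) * (τ ^ 3 * s) = 2 * (n * s) * τ := by field_simp
    have h5 : 2 * (n * s) * τ ≤ 2 * (n * s) * (1 / τ) := by
      gcongr
      rw [le_div_iff₀ hτ0]; nlinarith
    have h6 : 2 * s * (1 / θ) = 2 * (n * s) * (1 / τ) := by rw [hθ]; field_simp
    have h7 : 4 * s * n / τ = 4 * (n * s) * (1 / τ) := by field_simp
    rw [h6, h7]
    linarith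
  have hr0 : 0 < r := by linarith
  have hsr : 0 < Real.sqrt r := Real.sqrt_pos.2 hr0
  set c := 10 * s * τ / Real.sqrt r with hc
  have hc0 : 0 < c := by positivity
  refine (Es_mono hp (fun S => aux_fixed hs pr pc r l b hl hb ℓ Y hL hℓ w bad hbad hw S (V S)
    (hV0 S) (hV S) P hPne hnm c hc0)).trans ?_
  have hrew : ∀ S : Fin s → Fin n × Fin m,
      l * Real.sqrt r / s * ((6 * P * V S / c + c) / 2) + b / s * ∑ t, bad (S t)
      = (l * Real.sqrt r / s * (3 * P / c)) * V S
        + (l * Real.sqrt r / s * (c / 2) + b / s * ∑ t, bad (S t)) := by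
    intro S; ring
  simp only [hrew]
  rw [Es_add, Es_add, Es_mul, Es_one hp, Es_mul, Es_sum]
  have hEb : ∑ t, Esample s p (fun S => bad (S t)) ≤ s * (2 * τ) := by
    have h1 : ∑ a : Fin n × Fin m, p a.1 a.2 * bad a ≤ 2 * τ := by
      calc _ ≤ ∑ a : Fin n × Fin m, (p a.1 a.2 * (if θ ≤ pr a.1 then (0 : ℝ) else 1)
              + p a.1 a.2 * (if θ ≤ pc a.2 then (0 : ℝ) else 1)) := by
            refine Finset.sum_le_sum fun a _ => ?_
            rw [← mul_add]
            refine mul_le_mul_of_nonneg_left ?_ (hp.1 _ _)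
            simp only [bad]
            by_cases h1 : θ ≤ pr a.1 <;> by_cases h2 : θ ≤ pc a.2 <;> simp [h1, h2]
        _ = ∑ i, pr i * (if θ ≤ pr i then (0 : ℝ) else 1)
            + ∑ j, pc j * (if θ ≤ pc j then (0 : ℝ) else 1) := by
            rw [Finset.sum_add_distrib, Fintype.sum_prod_type, Fintype.sum_prod_type_right]
            congr 1
            · exact Finset.sum_congr rfl fun i _ =>
                (Finset.sum_mul Finset.univ (fun j => p i j) (if θ ≤ pr i then (0 : ℝ) else 1)).symm
            · exact Finset.sum_congr rfl fun j _ =>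
                (Finset.sum_mul Finset.univ (fun i => p i j) (if θ ≤ pc j then (0 : ℝ) else 1)).symm
        _ ≤ τ + τ := add_le_add (aux_badrow hn1 τ hτ0 le_rfl pr) (aux_badrow hn1 τ hτ0 hmn pc)
        _ = 2 * τ := by ring
    simp only [Es_single hp]
    rw [Finset.sum_const, Finset.card_univ, Fintype.card_fin, nsmul_eq_mul]
    gcongr
  have hb2 : b / s * ∑ t, Esample s p (fun S => bad (S t)) ≤ 2 * b * τ := by
    calc _ ≤ b / s * (s * (2 * τ)) := by gcongr
      _ = _ := by field_simp
  have hl2 : l * Real.sqrt r / s * (c / 2) = 5 * l * τ := by rw [hc]; field_simp; ring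
  have hEV0 : 0 ≤ Esample s p V := by
    have := Es_mono hp hV0
    rwa [Es_one hp] at this
  have hl1 : l * Real.sqrt r / s * (3 * P / c) * Esample s p V ≤ 5 * l * τ := by
    calc _ ≤ l * Real.sqrt r / s * (3 * (4 * Λ) / c) * (4 * s * n / τ) := by gcongr
      _ = 4.8 * l * (r * n * Λ / s) / τ ^ 2 := by
          rw [hc]
          nth_rw 3 [← Real.sq_sqrt hr0.le]
          field_simp
          ring
      _ = 4.8 * l * τ := by rw [← hy, ← hτ3]; field_simp
      _ ≤ _ := by
          have := mul_nonneg hl hτ0.le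
          linarith
  rw [hl2]
  have h1 := mul_nonneg hb hτ0.le
  have h2 : 10 * (l + b) * τ = 10 * l * τ + 10 * (b * τ) := by ring
  rw [h2]
  linarith

end
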